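/- Let C = Lie ∘ Com^∨ be the Koszul complex of the Lie operad with differential d_κ induced by the twisting morphism κ : Com^∨ → Lie sending the cogenerator to the Lie bracket generator. Then in each arity the homology of (Lie ∘ Com^∨, d_κ) is concentrated in the unit: H(C) ≅ I, the identity Σ-module. -/

import Mathlib

noncomputable section

open MvPolynomial
open scoped Classical

/-! **Statement 14.**  Koszulness of the Lie operad: the homology of the
Koszul complex `(Lie ∘ Com^∨, d_κ)` is, in each arity, concentrated in the
unit `Σ`-module `I`.  Over a field of characteristic `0` this arity-wise
statement is (by Schur–Weyl duality and linear duality) equivalent to the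
acyclicity of the *multilinear part* of the Harrison complex of the free
commutative algebra on `r` generators: the homology of the multilinear
Harrison complex vanishes for `r ≥ 2` and is one-dimensional (in homological
degree `1`) for `r = 1`.  We formalize the latter, with the Harrison complex
realized as the bar complex modulo shuffles. -/

/-- The `s`-fold tensor power of the free commutative algebra on `r`
generators (polynomials on `Fin s × Fin r`; first coordinate = bar slot). -/
abbrev KBarPart (r s : ℕ) := MvPolynomial (Fin s × Fin r) ℚ

/-- Collapsing slot `i+1` onto slot `i`. -/
def kcollapse {s : ℕ} (i : Fin s) (t : Fin (s + 1)) : Fin s :=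
  if h : (t : ℕ) ≤ (i : ℕ) then ⟨t, by omega⟩ else ⟨(t : ℕ) - 1, by omega⟩

/-- The bar differential. -/
def kbarDiff (r s : ℕ) : KBarPart r (s + 1) →ₗ[ℚ] KBarPart r s :=
  ∑ i : Fin s, ((-1 : ℚ) ^ (i : ℕ)) •
    (rename fun tv : Fin (s + 1) × Fin r => (kcollapse i tv.1, tv.2)).toLinearMap

/-- Each bar slot in the augmentation ideal. -/
def kbarSub (r s : ℕ) : Submodule ℚ (KBarPart r s) :=
  ⨅ i : Fin s, LinearMap.ker
    ((aeval fun p : Fin s × Fin r =>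
      if p.1 = i then (0 : KBarPart r s) else X p).toLinearMap)

/-- The shuffle submodule. -/
def kshuffleSub (r s : ℕ) : Submodule ℚ (KBarPart r s) :=
  Submodule.span ℚ {y | ∃ (p q : ℕ), 0 < p ∧ 0 < q ∧ p + q = s ∧
    ∃ x : KBarPart r s, y =
      ∑ τ : Equiv.Perm (Fin s),
        if (∀ a b : Fin s, (a : ℕ) < p → (b : ℕ) < p → a < b → τ a < τ b) ∧
           (∀ a b : Fin s, p ≤ (a : ℕ) → p ≤ (b : ℕ) → a < b → τ a < τ b)
        then ((Equiv.Perm.sign τ : ℤ) : ℚ) •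
          (rename fun tv : Fin s × Fin r => (τ tv.1, tv.2)) x
        else 0}

/-- The multilinear (arity-`r`) part: degree exactly `1` in each of the `r`
generators (jointly over all bar slots). -/
def kmultilinear (r s : ℕ) : Submodule ℚ (KBarPart r s) :=
  ⨅ v : Fin r, weightedHomogeneousSubmodule ℚ
    (fun p : Fin s × Fin r => if p.2 = v then (1 : ℕ) else 0) 1


/-- exponent of the multilinear monomial attached to `f` -/
def kmon {r s : ℕ} (f : Fin r → Fin s) : (Fin s × Fin r) →₀ ℕ :=
  ∑ v, Finsupp.single (f v, v) 1

lemma kmon_apply {r s : ℕ} (f : Fin r → Fin s) (i : Fin s) (v : Fin r) :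
    kmon f (i, v) = if f v = i then 1 else 0 := by
  unfold kmon
  rw [Finsupp.finsetSum_apply]
  simp only [Finsupp.single_apply, Prod.mk.injEq]
  rw [Finset.sum_eq_single v]
  · simp
  · intro b _ hb; simp [hb]
  · simp

lemma kmon_inj {r s : ℕ} {f g : Fin r → Fin s} (h : kmon f = kmon g) : f = g := by
  funext v
  have h1 := DFunLike.congr_fun h (g v, v)
  rw [kmon_apply, kmon_apply] at h1
  by_contra hne
  simp [hne] at h1

/-- multilinear monomial attached to `f` -/
def kX {r s : ℕ} (f : Fin r → Fin s) : KBarPart r s := monomial (kmon f) 1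

lemma coeff_kX {r s : ℕ} (f g : Fin r → Fin s) :
    coeff (kmon g) (kX f) = if f = g then 1 else 0 := by
  unfold kX
  rw [coeff_monomial]
  by_cases h : f = g
  · simp [h]
  · rw [if_neg h, if_neg (fun h' => h (kmon_inj h'))]

lemma kmon_map {r s s' : ℕ} (φ : Fin s → Fin s') (f : Fin r → Fin s) :
    (kmon f).mapDomain (fun tv : Fin s × Fin r => (φ tv.1, tv.2)) = kmon (φ ∘ f) := by
  unfold kmon
  rw [Finsupp.mapDomain_finsetSum]
  simp [Finsupp.mapDomain_single]

lemma rename_kX {r s s' : ℕ} (φ : Fin s → Fin s') (f : Fin r → Fin s) :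
    rename (fun tv : Fin s × Fin r => (φ tv.1, tv.2)) (kX f) = kX (φ ∘ f) := by
  unfold kX
  rw [rename_monomial, kmon_map]

lemma kbarDiff_apply (r s : ℕ) (x : KBarPart r (s+1)) :
    kbarDiff r s x = ∑ i : Fin s, ((-1 : ℚ) ^ (i : ℕ)) •
      (rename fun tv : Fin (s + 1) × Fin r => (kcollapse i tv.1, tv.2)) x := by
  simp [kbarDiff, LinearMap.sum_apply]

lemma kbarDiff_kX (r s : ℕ) (f : Fin r → Fin (s+1)) :
    kbarDiff r s (kX f) = ∑ i : Fin s, ((-1 : ℚ) ^ (i : ℕ)) • kX (kcollapse i ∘ f) := by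
  rw [kbarDiff_apply]
  simp only [rename_kX]

lemma kcollapse_val {s : ℕ} (i : Fin s) (t : Fin (s+1)) :
    (kcollapse i t : ℕ) = if (t : ℕ) ≤ i then (t : ℕ) else (t : ℕ) - 1 := by
  unfold kcollapse
  split_ifs <;> rfl

lemma kcollapse_surj {s : ℕ} (i : Fin s) : Function.Surjective (kcollapse i) := by
  intro j
  by_cases h : (j : ℕ) ≤ i
  · refine ⟨⟨j, by omega⟩, ?_⟩
    ext; rw [kcollapse_val]; simp; omega
  · refine ⟨⟨j+1, by omega⟩, ?_⟩
    ext; rw [kcollapse_val]; simp; omega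

/-- span of surjective multilinear monomials -/
def kSurj (r s : ℕ) : Submodule ℚ (KBarPart r s) :=
  Submodule.span ℚ {y | ∃ f : Fin r → Fin s, Function.Surjective f ∧ y = kX f}

lemma coeff_kill {r s : ℕ} (i : Fin s) (x : KBarPart r s) (m : (Fin s × Fin r) →₀ ℕ) :
    coeff m ((aeval fun p : Fin s × Fin r =>
      if p.1 = i then (0 : KBarPart r s) else X p) x) =
    if (∀ v, m (i, v) = 0) then coeff m x else 0 := by
  induction x using MvPolynomial.induction_on' with
  | add p q hp hq =>
    rw [map_add, coeff_add, hp, hq, coeff_add]; split_ifs <;> simp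
  | monomial u a =>
    rw [aeval_monomial]
    by_cases hu : ∀ v, u (i, v) = 0
    · have : (u.prod fun p k => (if p.1 = i then (0 : KBarPart r s) else X p) ^ k)
          = u.prod fun p k => X p ^ k := by
        apply Finsupp.prod_congr
        rintro ⟨j, v⟩ hp
        rw [if_neg]
        rintro rfl
        simp [hu] at hp
      rw [this, MvPolynomial.algebraMap_eq, ← monomial_eq, coeff_monomial]
      by_cases h : u = m
      · subst h; simp [hu]
      · simp [h]
    · push Not at hu
      obtain ⟨v, hv⟩ := hu
      have : (u.prod fun p k => (if p.1 = i then (0 : KBarPart r s) else X p) ^ k) = 0 := by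
        apply Finset.prod_eq_zero (i := (i, v))
        · simpa using hv
        · simp [hv]
      rw [this, mul_zero, coeff_zero, coeff_monomial]
      by_cases h : u = m
      · subst h
        rw [if_neg]
        intro h'; exact hv (h' v)
      · simp [h]

lemma mem_kbarSub {r s : ℕ} (x : KBarPart r s) :
    x ∈ kbarSub r s ↔ ∀ i : Fin s, ∀ m, coeff m x ≠ 0 → ∃ v, m (i, v) ≠ 0 := by
  unfold kbarSub
  simp only [Submodule.mem_iInf, LinearMap.mem_ker, AlgHom.toLinearMap_apply]
  refine forall_congr' fun i => ?_
  rw [MvPolynomial.ext_iff]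
  refine forall_congr' fun m => ?_
  rw [coeff_kill, coeff_zero]
  constructor
  · intro h hm
    by_contra hc
    push Not at hc
    rw [if_pos hc] at h
    exact hm h
  · intro h
    split_ifs with h2
    · by_contra hc
      obtain ⟨v, hv⟩ := h hc
      exact hv (h2 v)
    · rfl

lemma weight_slot {r s : ℕ} (v : Fin r) (m : (Fin s × Fin r) →₀ ℕ) :
    Finsupp.weight (fun p : Fin s × Fin r => if p.2 = v then (1 : ℕ) else 0) m
      = ∑ i, m (i, v) := by
  rw [Finsupp.weight_apply, Finsupp.sum_fintype _ _ (by simp), Fintype.sum_prod_type]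
  refine Finset.sum_congr rfl fun i _ => ?_
  simp

lemma mem_kmultilinear {r s : ℕ} (x : KBarPart r s) :
    x ∈ kmultilinear r s ↔ ∀ m, coeff m x ≠ 0 → ∃ f, m = kmon f := by
  unfold kmultilinear
  simp only [Submodule.mem_iInf, mem_weightedHomogeneousSubmodule, IsWeightedHomogeneous,
    weight_slot]
  constructor
  · intro h m hm
    have h1 : ∀ v, ∃ i, ∀ j, m (j, v) = if i = j then 1 else 0 := by
      intro v
      have h2 := h v hm
      obtain ⟨i, hi⟩ : ∃ i, m (i, v) ≠ 0 := by
        by_contra hc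
        push Not at hc
        simp [hc] at h2
      refine ⟨i, ?_⟩
      rw [← Finset.add_sum_erase _ _ (Finset.mem_univ i)] at h2
      have h3 : ∑ j ∈ Finset.univ.erase i, m (j, v) = 0 := by omega
      intro j
      split_ifs with hj
      · subst hj; omega
      · exact (Finset.sum_eq_zero_iff.1 h3) j (by simp [Ne.symm hj])
    choose f hf using h1
    refine ⟨f, ?_⟩
    ext ⟨j, v⟩
    rw [hf, kmon_apply]
  · intro h v m hm
    obtain ⟨f, rfl⟩ := h m hm
    simp [kmon_apply]

lemma kSurj_eq (r s : ℕ) : kmultilinear r s ⊓ kbarSub r s = kSurj r s := by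
  apply le_antisymm
  · rintro x ⟨hx1, hx2⟩
    rw [SetLike.mem_coe, mem_kmultilinear] at hx1
    rw [SetLike.mem_coe, mem_kbarSub] at hx2
    rw [x.as_sum]
    refine Submodule.sum_mem _ fun m hm => ?_
    rw [mem_support_iff] at hm
    obtain ⟨f, rfl⟩ := hx1 m hm
    have : monomial (kmon f) (coeff (kmon f) x) = coeff (kmon f) x • kX f := by
      rw [kX, smul_monomial, smul_eq_mul, mul_one]
    rw [this]
    refine Submodule.smul_mem _ _ (Submodule.subset_span ⟨f, ?_, rfl⟩)
    intro i
    obtain ⟨v, hv⟩ := hx2 i _ hm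
    rw [kmon_apply] at hv
    exact ⟨v, by by_contra hc; simp [hc] at hv⟩
  · refine Submodule.span_le.2 ?_
    rintro _ ⟨f, hf, rfl⟩
    have hc : ∀ m, coeff m (kX f) ≠ 0 → m = kmon f := by
      intro m hm
      rw [kX, coeff_monomial] at hm
      by_contra hc
      exact hm (if_neg (Ne.symm hc))
    refine ⟨?_, ?_⟩
    · rw [SetLike.mem_coe, mem_kmultilinear]
      intro m hm
      exact ⟨f, hc m hm⟩
    · rw [SetLike.mem_coe, mem_kbarSub]
      intro i m hm
      obtain ⟨v, hv⟩ := hf i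
      refine ⟨v, ?_⟩
      rw [hc m hm, kmon_apply, if_pos hv]
      simp

/-- shuffle permutations -/
def kIsShuf {s : ℕ} (p : ℕ) (τ : Equiv.Perm (Fin s)) : Prop :=
  (∀ a b : Fin s, (a : ℕ) < p → (b : ℕ) < p → a < b → τ a < τ b) ∧
  (∀ a b : Fin s, p ≤ (a : ℕ) → p ≤ (b : ℕ) → a < b → τ a < τ b)

/-- the shuffle operator -/
def kshufOp {r s : ℕ} (p : ℕ) (x : KBarPart r s) : KBarPart r s :=
  ∑ τ : Equiv.Perm (Fin s), if kIsShuf p τ then ((Equiv.Perm.sign τ : ℤ) : ℚ) •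
          (rename fun tv : Fin s × Fin r => (τ tv.1, tv.2)) x else 0

lemma kshuffleSub_eq (r s : ℕ) : kshuffleSub r s =
    Submodule.span ℚ {y | ∃ p : ℕ, 0 < p ∧ p < s ∧ ∃ x : KBarPart r s, y = kshufOp p x} := by
  unfold kshuffleSub
  congr 1
  ext y
  constructor
  · rintro ⟨p, q, hp, hq, hpq, x, rfl⟩
    refine ⟨p, hp, by omega, x, ?_⟩
    unfold kshufOp kIsShuf
    refine Finset.sum_congr rfl fun τ _ => ?_
    congr
  · rintro ⟨p, hp, hq, x, rfl⟩
    refine ⟨p, s - p, hp, by omega, by omega, x, ?_⟩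
    unfold kshufOp kIsShuf
    refine Finset.sum_congr rfl fun τ _ => ?_
    congr

lemma kshufOp_mem {r s : ℕ} (p : ℕ) (hp : 0 < p) (hs : p < s) (x : KBarPart r s) :
    kshufOp p x ∈ kshuffleSub r s := by
  rw [kshuffleSub_eq]
  exact Submodule.subset_span ⟨p, hp, hs, x, rfl⟩

lemma perm_strictMono_eq_one {s : ℕ} (τ : Equiv.Perm (Fin s)) (h : StrictMono τ) : τ = 1 := by
  have := Subsingleton.elim (StrictMono.orderIsoOfSurjective τ h τ.surjective) (OrderIso.refl _)
  ext i
  have h2 := DFunLike.congr_fun this i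
  simpa using congrArg Fin.val h2

lemma shuf_lt {s : ℕ} (p : Fin s) (τ : Equiv.Perm (Fin s)) (h : kIsShuf p τ) (h1 : τ ≠ 1) :
    τ p < p := by
  by_contra hc
  push Not at hc
  apply h1
  apply perm_strictMono_eq_one
  have hmap : ∀ b, p ≤ b → p ≤ τ b := by
    intro b hb
    rcases hb.eq_or_lt with rfl | hb
    · exact hc
    · exact hc.trans (h.2 p b le_rfl hb.le hb).le
  have himg : (Finset.Ici p).image τ = Finset.Ici p := by
    apply Finset.eq_of_subset_of_card_le
    · intro y hy
      simp only [Finset.mem_image, Finset.mem_Ici] at hy ⊢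
      obtain ⟨b, hb, rfl⟩ := hy
      exact hmap b hb
    · rw [Finset.card_image_of_injective _ τ.injective]
  have hlow : ∀ a, a < p → τ a < p := by
    intro a ha
    by_contra hc
    push Not at hc
    have : τ a ∈ (Finset.Ici p).image τ := by rw [himg]; simpa using hc
    simp only [Finset.mem_image, Finset.mem_Ici] at this
    obtain ⟨b, hb, hb2⟩ := this
    have := τ.injective hb2
    omega
  intro a b hab
  by_cases ha : a < p
  · by_cases hb : b < p
    · exact h.1 a b ha hb hab
    · push Not at hb
      exact (hlow a ha).trans_le (hmap b hb)
  · push Not at ha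
    exact h.2 a b ha (ha.trans hab.le) hab

/-- span of surjective monomials with the generator `0` in the first slot -/
def kF (R s : ℕ) : Submodule ℚ (KBarPart (R+1) s) :=
  Submodule.span ℚ {y | ∃ f : Fin (R+1) → Fin s, Function.Surjective f ∧ (f 0 : ℕ) = 0 ∧ y = kX f}

lemma isShuf_one {s : ℕ} (p : ℕ) : kIsShuf p (1 : Equiv.Perm (Fin s)) :=
  ⟨fun _ _ _ _ h => h, fun _ _ _ _ h => h⟩

lemma kX_mem_sup {R s : ℕ} (n : ℕ) : ∀ (f : Fin (R+1) → Fin s), Function.Surjective f →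
    (f 0 : ℕ) = n → kX f ∈ kF R s ⊔ kshuffleSub (R+1) s := by
  induction n using Nat.strong_induction_on with
  | _ n ih =>
    intro f hf hn
    rcases Nat.eq_zero_or_pos n with rfl | hpos
    · exact Submodule.mem_sup_left (Submodule.subset_span ⟨f, hf, hn, rfl⟩)
    · have hy := kshufOp_mem (f 0 : ℕ) (by omega) (f 0).2 (kX f)
      have hsum : kX f = kshufOp (f 0 : ℕ) (kX f) - ∑ τ ∈ Finset.univ.erase (1 : Equiv.Perm (Fin s)),
          if kIsShuf (f 0 : ℕ) τ then ((Equiv.Perm.sign τ : ℤ) : ℚ) • kX (τ ∘ f) else 0 := by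
        unfold kshufOp
        simp only [rename_kX]
        rw [← Finset.add_sum_erase _ _ (Finset.mem_univ (1 : Equiv.Perm (Fin s))),
          add_sub_cancel_right, if_pos (isShuf_one _)]
        simp
      rw [hsum]
      refine Submodule.sub_mem _ (Submodule.mem_sup_right hy) (Submodule.sum_mem _ fun τ hτ => ?_)
      split_ifs with hs
      · refine Submodule.smul_mem _ _ (ih _ ?_ (τ ∘ f) (τ.surjective.comp hf) rfl)
        have := shuf_lt (f 0) τ hs (by simpa using hτ)
        rw [← hn]
        exact this
      · exact Submodule.zero_mem _

lemma kSurj_le_sup (R s : ℕ) : kSurj (R+1) s ≤ kF R s ⊔ kshuffleSub (R+1) s := by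
  refine Submodule.span_le.2 ?_
  rintro _ ⟨f, hf, rfl⟩
  exact kX_mem_sup _ f hf rfl

/-- sorting permutation attached to a set `L` of letters to be put on the left -/
def kg {n : ℕ} (L : Finset (Fin (n+1))) : Equiv.Perm (Fin (n+1)) :=
  (Tuple.sort (fun b : Fin (n+1) => if b ∈ L then -((b : ℕ) : ℤ) else ((b : ℕ) : ℤ)))⁻¹

lemma kg_lt {n : ℕ} (L : Finset (Fin (n+1))) {k l : Fin (n+1)} (h : k < l) :
    kg L k < kg L l ↔ l ∉ L := by
  set K : Fin (n+1) → ℤ := fun b => if b ∈ L then -((b : ℕ) : ℤ) else ((b : ℕ) : ℤ) with hK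
  have hinj : Function.Injective K := by
    intro a b hab
    simp only [hK] at hab
    ext
    split_ifs at hab <;> omega
  have hmono : StrictMono (K ∘ Tuple.sort K) :=
    (Tuple.monotone_sort K).strictMono_of_injective (hinj.comp (Tuple.sort K).injective)
  have h1 : kg L k < kg L l ↔ K k < K l := by
    rw [← hmono.lt_iff_lt]
    have : ∀ a, (K ∘ Tuple.sort K) (kg L a) = K a := by
      intro a
      change K (Tuple.sort K ((Tuple.sort K)⁻¹ a)) = K a
      simp
    rw [this, this]
  rw [h1]
  simp only [hK]
  have : (k : ℕ) < l := h
  split_ifs <;> simp_all <;> omega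

lemma kg_empty {n : ℕ} : kg (∅ : Finset (Fin (n+1))) = 1 := by
  apply perm_strictMono_eq_one
  intro a b hab
  rw [kg_lt _ hab]
  simp

lemma isShuf_iff {s : ℕ} (p : ℕ) (τ : Equiv.Perm (Fin s)) :
    kIsShuf p τ ↔ ∀ a b : Fin s, a < b → ((a : ℕ) < p ↔ (b : ℕ) < p) → τ a < τ b := by
  constructor
  · intro h a b hab hs
    by_cases ha : (a : ℕ) < p
    · exact h.1 a b ha (hs.1 ha) hab
    · exact h.2 a b (by omega) (by omega) hab
  · intro h
    exact ⟨fun a b ha hb hab => h a b hab (by omega), fun a b ha hb hab => h a b hab (by omega)⟩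

lemma isShuf_kg {n : ℕ} (p : ℕ) (ρ : Equiv.Perm (Fin (n+1))) (L : Finset (Fin (n+1))) :
    kIsShuf p (kg L * ρ⁻¹) ↔ ∀ k l, k < l → ((ρ k : ℕ) < p ↔ (ρ l : ℕ) < p) →
      (ρ k < ρ l ↔ l ∉ L) := by
  rw [isShuf_iff]
  constructor
  · intro h k l hkl hs
    rw [← kg_lt L hkl]
    rcases lt_or_gt_of_ne (fun e => hkl.ne (ρ.injective e)) with h1 | h1
    · have := h _ _ h1 hs
      simp at this
      tauto
    · have := h _ _ h1 hs.symm
      simp at this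
      constructor
      · intro h2; exact absurd h2 h1.asymm
      · intro h2; exact absurd h2 this.asymm
  · intro h a b hab hs
    obtain ⟨k, rfl⟩ := ρ.surjective a
    obtain ⟨l, rfl⟩ := ρ.surjective b
    have hinv : ∀ c, (kg L * ρ⁻¹) (ρ c) = kg L c := fun c => by simp
    rw [hinv, hinv]
    rcases lt_or_gt_of_ne (fun e : k = l => hab.ne (congrArg ρ e)) with h1 | h1
    · rw [kg_lt L h1]
      exact (h k l h1 hs).1 hab
    · have h2 := h l k h1 hs.symm
      rw [← kg_lt L h1] at h2
      have h3 : ¬ (kg L l < kg L k) := fun h3 => (h2.2 h3).asymm hab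
      push Not at h3
      exact lt_of_le_of_ne h3 (fun e => h1.ne ((kg L).injective e).symm)

lemma sum_valley {n : ℕ} (p : ℕ) (hp : 0 < p) (hpn : p < n + 1) (ρ : Equiv.Perm (Fin (n+1))) :
    ∑ L ∈ (Finset.univ : Finset (Finset (Fin (n+1)))).filter (fun L => 0 ∉ L),
      (if kIsShuf p (kg L * ρ⁻¹) then ((-1 : ℚ)) ^ L.card else 0) = 0 := by
  obtain ⟨m, hm, hmin⟩ : ∃ m : Fin (n+1), (¬ ((ρ 0 : ℕ) < p ↔ (ρ m : ℕ) < p)) ∧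
      ∀ k, k < m → ((ρ 0 : ℕ) < p ↔ (ρ k : ℕ) < p) := by
    have hne : ((Finset.univ : Finset (Fin (n+1))).filter
        (fun m => ¬ ((ρ 0 : ℕ) < p ↔ (ρ m : ℕ) < p))).Nonempty := by
      by_cases h0 : (ρ 0 : ℕ) < p
      · refine ⟨ρ⁻¹ ⟨p, hpn⟩, ?_⟩
        simp [h0]
      · refine ⟨ρ⁻¹ ⟨0, by omega⟩, ?_⟩
        simp [hp]
        omega
    refine ⟨Finset.min' _ hne, ?_, ?_⟩
    · have := Finset.min'_mem _ hne
      rw [Finset.mem_filter] at this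
      exact this.2
    · intro k hk
      by_contra hc
      have := Finset.min'_le ((Finset.univ : Finset (Fin (n+1))).filter
        (fun m => ¬ ((ρ 0 : ℕ) < p ↔ (ρ m : ℕ) < p))) k (by simpa using hc)
      exact absurd hk (not_lt.2 this)
  have hm0 : m ≠ 0 := by
    rintro rfl
    exact hm Iff.rfl
  have hinv : ∀ L, kIsShuf p (kg (symmDiff L {m}) * ρ⁻¹) ↔ kIsShuf p (kg L * ρ⁻¹) := by
    intro L
    rw [isShuf_kg, isShuf_kg]
    refine forall_congr' fun k => forall_congr' fun l => forall_congr' fun hkl =>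
      forall_congr' fun hs => ?_
    have hlm : l ≠ m := by
      rintro rfl
      exact hm ((hmin k hkl).trans hs)
    simp [Finset.mem_symmDiff, hlm]
  apply Finset.sum_involution (fun L _ => symmDiff L {m})
  · intro L hL
    by_cases h : kIsShuf p (kg L * ρ⁻¹)
    · rw [if_pos h, if_pos ((hinv L).2 h)]
      by_cases hmL : m ∈ L
      · have : L = insert m (symmDiff L {m}) := by
          ext a; simp [Finset.mem_symmDiff]; by_cases a = m <;> simp_all
        have hc : L.card = (symmDiff L {m}).card + 1 := by
          conv_lhs => rw [this]
          rw [Finset.card_insert_of_notMem]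
          simp [Finset.mem_symmDiff, hmL]
        rw [hc, pow_succ]; ring
      · have : symmDiff L {m} = insert m L := by
          ext a; simp [Finset.mem_symmDiff]; by_cases a = m <;> simp_all
        rw [this, Finset.card_insert_of_notMem hmL, pow_succ]; ring
    · rw [if_neg h, if_neg (fun h' => h ((hinv L).1 h')), add_zero]
  · intro L _ _ he
    have := symmDiff_eq_left.1 he
    simp at this
  · intro L _
    simp
  · intro L hL
    simp only [Finset.mem_filter, Finset.mem_univ, true_and] at hL ⊢
    simp [Finset.mem_symmDiff, hL, Ne.symm hm0]

/-- the Lie functional attached to `f` -/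
def kPhi {r n : ℕ} (f : Fin r → Fin (n+1)) : KBarPart r (n+1) →ₗ[ℚ] ℚ :=
  ∑ L ∈ (Finset.univ : Finset (Finset (Fin (n+1)))).filter (fun L => 0 ∉ L),
    ((-1 : ℚ) ^ L.card * ((Equiv.Perm.sign (kg L) : ℤ) : ℚ)) • lcoeff ℚ (kmon (kg L ∘ f))

lemma kPhi_apply {r n : ℕ} (f : Fin r → Fin (n+1)) (x : KBarPart r (n+1)) :
    kPhi f x = ∑ L ∈ (Finset.univ : Finset (Finset (Fin (n+1)))).filter (fun L => 0 ∉ L),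
    ((-1 : ℚ) ^ L.card * ((Equiv.Perm.sign (kg L) : ℤ) : ℚ)) * coeff (kmon (kg L ∘ f)) x := by
  simp [kPhi, LinearMap.sum_apply]

lemma coeff_rename_perm {r s : ℕ} (τ : Equiv.Perm (Fin s)) (h : Fin r → Fin s)
    (x : KBarPart r s) :
    coeff (kmon (τ ∘ h)) (rename (fun tv : Fin s × Fin r => (τ tv.1, tv.2)) x)
      = coeff (kmon h) x := by
  rw [← kmon_map]
  apply coeff_rename_mapDomain
  rintro ⟨a, b⟩ ⟨c, d⟩ h
  simpa using h

lemma kPhi_shuf {r n : ℕ} (f : Fin r → Fin (n+1)) (p : ℕ) (hp : 0 < p) (hpn : p < n + 1)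
    (x : KBarPart r (n+1)) : kPhi f (kshufOp p x) = 0 := by
  rw [kPhi_apply]
  have key : ∀ L : Finset (Fin (n+1)),
      ((-1 : ℚ) ^ L.card * ((Equiv.Perm.sign (kg L) : ℤ) : ℚ)) *
        coeff (kmon (kg L ∘ f)) (kshufOp p x) =
      ∑ ρ : Equiv.Perm (Fin (n+1)), (if kIsShuf p (kg L * ρ⁻¹) then ((-1 : ℚ)) ^ L.card else 0) *
        (((Equiv.Perm.sign ρ : ℤ) : ℚ) * coeff (kmon (ρ ∘ f)) x) := by
    intro L
    unfold kshufOp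
    rw [coeff_sum, ← Equiv.sum_comp ((Equiv.inv _).trans (Equiv.mulLeft (kg L))), Finset.mul_sum]
    refine Finset.sum_congr rfl fun ρ _ => ?_
    simp only [Equiv.trans_apply, Equiv.inv_apply, Equiv.coe_mulLeft]
    split_ifs with h
    · have h1 : kg L ∘ f = (kg L * ρ⁻¹) ∘ (ρ ∘ f) := by
        funext v; simp
      rw [coeff_smul, h1, coeff_rename_perm]
      have h2 : ((Equiv.Perm.sign (kg L) : ℤ) : ℚ) * ((Equiv.Perm.sign (kg L * ρ⁻¹) : ℤ) : ℚ)
          = ((Equiv.Perm.sign ρ : ℤ) : ℚ) := by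
        rw [Equiv.Perm.sign_mul, Equiv.Perm.sign_inv, ← Int.cast_mul, ← Units.val_mul, ← mul_assoc,
          Int.units_mul_self, one_mul]
      rw [smul_eq_mul, ← h2]; ring
    · simp
  rw [Finset.sum_congr rfl fun L _ => key L, Finset.sum_comm]
  refine Finset.sum_eq_zero fun ρ _ => ?_
  rw [← Finset.sum_mul, sum_valley p hp hpn, zero_mul]

lemma kPhi_sh {r n : ℕ} (f : Fin r → Fin (n+1)) (x : KBarPart r (n+1))
    (hx : x ∈ kshuffleSub r (n+1)) : kPhi f x = 0 := by
  have : kshuffleSub r (n+1) ≤ LinearMap.ker (kPhi f) := by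
    rw [kshuffleSub_eq]
    refine Submodule.span_le.2 ?_
    rintro _ ⟨p, hp, hpn, x, rfl⟩
    exact kPhi_shuf f p hp hpn x
  exact this hx

lemma coeff_kF {R s : ℕ} (x : KBarPart (R+1) s) (hx : x ∈ kF R s) (m : (Fin s × Fin (R+1)) →₀ ℕ)
    (hm : coeff m x ≠ 0) : ∃ f : Fin (R+1) → Fin s,
      Function.Surjective f ∧ (f 0 : ℕ) = 0 ∧ m = kmon f := by
  unfold kF at hx
  induction hx using Submodule.span_induction with
  | mem x h =>
    obtain ⟨f, hf, hf0, rfl⟩ := h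
    refine ⟨f, hf, hf0, ?_⟩
    by_contra hc
    apply hm
    rw [kX, coeff_monomial, if_neg (Ne.symm hc)]
  | zero => simp at hm
  | add x y _ _ hx hy =>
    by_cases h : coeff m x = 0
    · apply hy; rw [coeff_add, h, zero_add] at hm; exact hm
    · exact hx h
  | smul a x _ hx =>
    apply hx
    rw [coeff_smul] at hm
    exact right_ne_zero_of_smul hm

lemma kF_inf_sh {R n : ℕ} (x : KBarPart (R+1) (n+1)) (hx : x ∈ kF R (n+1))
    (hs : x ∈ kshuffleSub (R+1) (n+1)) : x = 0 := by
  ext m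
  rw [coeff_zero]
  by_contra hm
  obtain ⟨f, hf, hf0, rfl⟩ := coeff_kF x hx m hm
  apply hm
  have h := kPhi_sh f x hs
  rw [kPhi_apply, Finset.sum_eq_single ∅] at h
  · simpa [kg_empty] using h
  · intro L hL hL0
    rw [Finset.mem_filter] at hL
    convert mul_zero _
    by_contra hc
    obtain ⟨f', _, hf0', he⟩ := coeff_kF x hx _ hc
    have he := kmon_inj he
    rw [← he] at hf0'
    have h00 : f 0 = 0 := by ext; simpa using hf0
    simp only [Function.comp, h00] at hf0'
    obtain ⟨l, hl⟩ := Finset.nonempty_iff_ne_empty.2 hL0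
    have hl0 : (0 : Fin (n+1)) < l := by
      rw [Fin.pos_iff_ne_zero]
      rintro rfl
      exact hL.2 hl
    apply (kg_lt L hl0).not.2 (not_not.2 hl)
    rw [Fin.lt_def, hf0']
    have : kg L 0 ≠ kg L l := fun e => hl0.ne ((kg L).injective e)
    by_contra hc
    apply this
    ext
    omega
  · intro h; simp at h

/-- split the first block -/
def ksplit {R s : ℕ} (f : Fin (R+1) → Fin s) : Fin (R+1) → Fin (s+1) :=
  fun v => if v = 0 then 0 else (f v).succ

/-- homotopy on monomials -/
def khX {R s : ℕ} (f : Fin (R+1) → Fin s) : KBarPart (R+1) (s+1) :=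
  if (∃ v, v ≠ 0 ∧ (f v : ℕ) = 0) then kX (ksplit f) else 0

/-- homotopy -/
def kH (R s : ℕ) : KBarPart (R+1) s →ₗ[ℚ] KBarPart (R+1) (s+1) :=
  ∑ f : Fin (R+1) → Fin s, (lcoeff ℚ (kmon f)).smulRight (khX f)

lemma kH_kX {R s : ℕ} (f : Fin (R+1) → Fin s) : kH R s (kX f) = khX f := by
  simp [kH, LinearMap.sum_apply, coeff_kX]

lemma kH_mem {R s : ℕ} (x : KBarPart (R+1) s) (hx : x ∈ kF R s) :
    kH R s x ∈ kSurj (R+1) (s+1) := by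
  have : kF R s ≤ (kSurj (R+1) (s+1)).comap (kH R s) := by
    refine Submodule.span_le.2 ?_
    rintro _ ⟨f, hf, hf0, rfl⟩
    rw [SetLike.mem_coe, Submodule.mem_comap, kH_kX, khX]
    split_ifs with h
    · refine Submodule.subset_span ⟨_, ?_, rfl⟩
      intro i
      refine Fin.cases ⟨0, by simp [ksplit]⟩ (fun k => ?_) i
      obtain ⟨v, hv⟩ := hf k
      by_cases hv0 : v = 0
      · obtain ⟨w, hw, hw0⟩ := h
        refine ⟨w, ?_⟩
        subst hv0
        simp only [ksplit, hw, if_false]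
        congr 1
        rw [← hv]
        ext; omega
      · exact ⟨v, by simp [ksplit, hv0, hv]⟩
    · exact Submodule.zero_mem _
  exact this hx

lemma khomotopy_kX {R n : ℕ} (f : Fin (R+1) → Fin (n+1)) (hf : Function.Surjective f)
    (hf0 : (f 0 : ℕ) = 0) (h : n ≠ 0 ∨ R ≠ 0) :
    kbarDiff (R+1) (n+1) (kH R (n+1) (kX f)) + kH R n (kbarDiff (R+1) n (kX f)) = kX f := by
  rw [kbarDiff_kX, map_sum, kH_kX]
  simp only [map_smul, kH_kX]
  by_cases hC : ∃ v, v ≠ 0 ∧ (f v : ℕ) = 0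
  · rw [khX, if_pos hC, kbarDiff_kX, Fin.sum_univ_succ]
    have h0 : kcollapse 0 ∘ ksplit f = f := by
      funext v
      ext
      simp only [Function.comp, kcollapse_val, ksplit]
      split_ifs with h1 <;> simp_all
    rw [h0]
    have h1 : ∀ k : Fin n, khX (kcollapse k ∘ f) = kX (kcollapse k.succ ∘ ksplit f) := by
      intro k
      rw [khX, if_pos]
      · congr 1
        funext v
        ext
        by_cases hv : v = 0
        · simp [kcollapse_val, ksplit, hv]
        · simp only [Function.comp, kcollapse_val, ksplit, hv, if_false, Fin.val_succ]
          split_ifs <;> omega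
      · obtain ⟨v, hv, hv0⟩ := hC
        exact ⟨v, hv, by simp [kcollapse_val, hv0]⟩
    simp only [h1, Fin.val_succ, pow_succ]
    simp
  · rw [khX, if_neg hC, map_zero, zero_add]
    push Not at hC
    obtain _ | n := n
    · exfalso
      have hR : R ≠ 0 := by simpa using h
      obtain ⟨R, rfl⟩ := Nat.exists_eq_succ_of_ne_zero hR
      apply hC 1
      · simp
      · omega
    · rw [Fin.sum_univ_succ, Finset.sum_eq_zero]
      · rw [khX, if_pos]
        · simp only [Fin.val_zero, pow_zero, one_smul, add_zero]
          congr 1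
          funext v
          ext
          simp only [Function.comp, ksplit]
          split_ifs with h1
          · subst h1; simp [hf0]
          · have := hC v h1
            simp [kcollapse_val]
            split_ifs with h2
            · simp [h2] at this
            · omega
        · obtain ⟨v, hv⟩ := hf 1
          refine ⟨v, ?_, ?_⟩
          · rintro rfl; simp [hv] at hf0
          · simp [kcollapse_val, hv]
      · intro k _
        rw [khX, if_neg, smul_zero]
        rintro ⟨v, hv, hv0⟩
        have := hC v hv
        simp only [Function.comp, kcollapse_val, Fin.val_succ] at hv0
        split_ifs at hv0 <;> omega

lemma khomotopy {R n : ℕ} (h : n ≠ 0 ∨ R ≠ 0) (x : KBarPart (R+1) (n+1)) (hx : x ∈ kF R (n+1)) :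
    kbarDiff (R+1) (n+1) (kH R (n+1) x) + kH R n (kbarDiff (R+1) n x) = x := by
  unfold kF at hx
  induction hx using Submodule.span_induction with
  | mem x hm => obtain ⟨f, hf, hf0, rfl⟩ := hm; exact khomotopy_kX f hf hf0 h
  | zero => simp
  | add x y _ _ hx hy =>
    simp only [map_add]
    rw [add_add_add_comm, hx, hy]
  | smul a x _ hx =>
    simp only [map_smul]
    rw [← smul_add, hx]

lemma kF_diff {R s : ℕ} (x : KBarPart (R+1) (s+1)) (hx : x ∈ kF R (s+1)) :
    kbarDiff (R+1) s x ∈ kF R s := by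
  have : kF R (s+1) ≤ (kF R s).comap (kbarDiff (R+1) s) := by
    refine Submodule.span_le.2 ?_
    rintro _ ⟨f, hf, hf0, rfl⟩
    rw [SetLike.mem_coe, Submodule.mem_comap, kbarDiff_kX]
    refine Submodule.sum_mem _ fun i _ => Submodule.smul_mem _ _ (Submodule.subset_span
      ⟨_, (kcollapse_surj i).comp hf, ?_, rfl⟩)
    simp [kcollapse_val, hf0]
  exact this hx

/-- slotwise renaming -/
def kR {r s s' : ℕ} (φ : Fin s → Fin s') (x : KBarPart r s) : KBarPart r s' :=
  rename (fun tv : Fin s × Fin r => (φ tv.1, tv.2)) x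

lemma kR_kR {r s s' s'' : ℕ} (φ : Fin s' → Fin s'') (ψ : Fin s → Fin s') (x : KBarPart r s) :
    kR φ (kR ψ x) = kR (φ ∘ ψ) x := by
  unfold kR
  rw [rename_rename]
  rfl

lemma kbarDiff_kR (r s : ℕ) (x : KBarPart r (s+1)) :
    kbarDiff r s x = ∑ i : Fin s, ((-1 : ℚ) ^ (i : ℕ)) • kR (kcollapse i) x :=
  kbarDiff_apply r s x

lemma kshufOp_kR {r s : ℕ} (p : ℕ) (x : KBarPart r s) : kshufOp p x =
    ∑ τ : Equiv.Perm (Fin s),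
      if kIsShuf p τ then ((Equiv.Perm.sign τ : ℤ) : ℚ) • kR τ x else 0 := rfl

lemma kR_sum {ι : Type*} {r s s' : ℕ} (φ : Fin s → Fin s') (S : Finset ι) (F : ι → KBarPart r s) :
    kR φ (∑ i ∈ S, F i) = ∑ i ∈ S, kR φ (F i) := by
  unfold kR; rw [map_sum]

lemma kR_smul {r s s' : ℕ} (φ : Fin s → Fin s') (c : ℚ) (x : KBarPart r s) :
    kR φ (c • x) = c • kR φ x := by
  unfold kR; rw [map_smul]

lemma kR_zero {r s s' : ℕ} (φ : Fin s → Fin s') :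
    kR φ (0 : KBarPart r s) = 0 := by
  unfold kR; rw [map_zero]

lemma kbarDiff_sq (r s : ℕ) (x : KBarPart r (s+2)) :
    kbarDiff r s (kbarDiff r (s+1) x) = 0 := by
  rw [kbarDiff_kR, kbarDiff_kR]
  simp only [kR_sum, kR_smul, kR_kR, Finset.smul_sum, smul_smul]
  rw [← Fintype.sum_prod_type' (f := fun (i : Fin s) (j : Fin (s+1)) =>
    ((-1 : ℚ) ^ (i : ℕ) * (-1) ^ (j : ℕ)) • kR (kcollapse i ∘ kcollapse j) x)]
  apply Finset.sum_involution (fun (q : Fin s × Fin (s+1)) _ =>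
    if h : (q.2 : ℕ) ≤ q.1 then ((⟨q.2, by omega⟩, q.1.succ) : Fin s × Fin (s+1))
    else (⟨q.2 - 1, by omega⟩, q.1.castSucc))
  · rintro ⟨i, j⟩ _
    by_cases h : (j : ℕ) ≤ i
    · simp only [h, dif_pos]
      have : kcollapse i ∘ kcollapse j = kcollapse ⟨j, by omega⟩ ∘ kcollapse i.succ := by
        funext t
        ext
        simp only [Function.comp, kcollapse_val, Fin.val_succ]
        split_ifs <;> omega
      rw [this, ← add_smul, Fin.val_succ, pow_succ]
      refine smul_eq_zero_of_left ?_ _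
      ring
    · simp only [h, dif_neg, not_false_iff]
      have : kcollapse i ∘ kcollapse j = kcollapse ⟨j - 1, by omega⟩ ∘ kcollapse i.castSucc := by
        funext t
        ext
        simp only [Function.comp, kcollapse_val, Fin.val_castSucc]
        split_ifs <;> omega
      rw [this, ← add_smul, Fin.val_castSucc]
      refine smul_eq_zero_of_left ?_ _
      obtain ⟨k, hk⟩ : ∃ k, (j : ℕ) = k + 1 := ⟨j - 1, by omega⟩
      have hk' : (j : ℕ) - 1 = k := by omega
      simp only [hk']
      rw [hk, pow_succ]
      ring
  · rintro ⟨i, j⟩ _ _ he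
    split_ifs at he with h
    · have := congrArg (fun q => (q.2 : ℕ)) he
      simp at this
      simp at h
      omega
    · have := congrArg (fun q => (q.2 : ℕ)) he
      simp at this
      simp at h
      omega
  · rintro ⟨i, j⟩ _
    by_cases h : (j : ℕ) ≤ i
    · have h2 : ¬ ((i : ℕ) + 1 ≤ j) := by omega
      simp [h, h2]
    · have h2 : (i : ℕ) ≤ j - 1 := by omega
      simp [h, h2]
      ext
      simp; omega
  · simp

/-- extension of a permutation -/
def kE {s : ℕ} (a b : Fin (s+1)) (q : Fin (s+1) × Equiv.Perm (Fin s)) : Equiv.Perm (Fin (s+1)) :=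
  a.cycleRange⁻¹ * Equiv.Perm.decomposeFin.symm q * b.cycleRange

lemma kE_self {s : ℕ} (a b : Fin (s+1)) (q) : kE a b q b = a.cycleRange.symm q.1 := by
  obtain ⟨q, e⟩ := q
  simp [kE, Equiv.Perm.mul_apply, Fin.cycleRange_self]

lemma kE_succAbove {s : ℕ} (a b : Fin (s+1)) (e : Equiv.Perm (Fin s)) (k : Fin s) :
    kE a b (0, e) (b.succAbove k) = a.succAbove (e k) := by
  simp [kE, Equiv.Perm.mul_apply, Fin.cycleRange_succAbove]

lemma kE_sign {s : ℕ} (a b : Fin (s+1)) (e : Equiv.Perm (Fin s)) :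
    Equiv.Perm.sign (kE a b (0, e)) = (-1) ^ (a : ℕ) * Equiv.Perm.sign e * (-1) ^ (b : ℕ) := by
  simp [kE, Fin.sign_cycleRange, Equiv.Perm.decomposeFin.symm_sign]

lemma sum_kE {M : Type*} [AddCommMonoid M] {s : ℕ} (a b : Fin (s+1))
    (G : Equiv.Perm (Fin (s+1)) → M) :
    (∑ τ, if τ b = a then G τ else 0) = ∑ e, G (kE a b (0, e)) := by
  let E : Fin (s+1) × Equiv.Perm (Fin s) ≃ Equiv.Perm (Fin (s+1)) :=
    Equiv.Perm.decomposeFin.symm.trans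
      ((Equiv.mulLeft (a.cycleRange⁻¹)).trans (Equiv.mulRight b.cycleRange))
  have hE : ∀ q, E q = kE a b q := fun q => rfl
  rw [← Equiv.sum_comp E, Fintype.sum_prod_type, Finset.sum_eq_single 0]
  · refine Finset.sum_congr rfl fun e _ => ?_
    rw [hE, if_pos]
    rw [kE_self, Fin.cycleRange_symm_zero]
  · intro q _ hq
    refine Finset.sum_eq_zero fun e _ => ?_
    rw [hE, if_neg]
    rw [kE_self]
    intro h
    apply hq
    apply a.cycleRange.symm.injective
    rw [Fin.cycleRange_symm_zero]
    exact h
  · simp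

/-- slots `i`, `i+1` come from the same side -/
def kSame {s : ℕ} (p : ℕ) (i : Fin s) (τ : Equiv.Perm (Fin (s+1))) : Prop :=
  ((τ⁻¹ i.castSucc : ℕ) < p ↔ (τ⁻¹ i.succ : ℕ) < p)

lemma swap_shuf {s : ℕ} (p : ℕ) (i : Fin s) (τ : Equiv.Perm (Fin (s+1)))
    (h : kIsShuf p τ ∧ ¬ kSame p i τ) :
    kIsShuf p (Equiv.swap i.castSucc i.succ * τ) ∧
      ¬ kSame p i (Equiv.swap i.castSucc i.succ * τ) := by
  obtain ⟨h1, h2⟩ := h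
  constructor
  · rw [isShuf_iff] at h1 ⊢
    intro a b hab hs
    have h3 := h1 a b hab hs
    have h4 : ¬ (τ a = i.castSucc ∧ τ b = i.succ) := by
      rintro ⟨h5, h6⟩
      apply h2
      unfold kSame
      rw [← h5, ← h6]
      simpa using hs
    simp only [Equiv.Perm.mul_apply, Equiv.swap_apply_def]
    simp only [Fin.ext_iff, Fin.lt_def, Fin.val_castSucc, Fin.val_succ] at h3 h4 ⊢
    split_ifs <;> (try simp only [Fin.val_castSucc, Fin.val_succ]) <;> omega
  · unfold kSame at h2 ⊢
    intro h3
    apply h2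
    rw [mul_inv_rev, Equiv.swap_inv] at h3
    simp only [Equiv.Perm.mul_apply, Equiv.swap_apply_left, Equiv.swap_apply_right] at h3
    exact h3.symm

lemma collapse_swap {s : ℕ} (i : Fin s) (t : Fin (s+1)) :
    kcollapse i (Equiv.swap i.castSucc i.succ t) = kcollapse i t := by
  ext
  rw [Equiv.swap_apply_def]
  simp only [kcollapse_val, Fin.ext_iff, Fin.val_castSucc, Fin.val_succ]
  split_ifs <;> simp_all

lemma cross_zero {r s : ℕ} (p : ℕ) (i : Fin s) (x : KBarPart r (s+1)) :
    ∑ τ : Equiv.Perm (Fin (s+1)), (if kIsShuf p τ ∧ ¬ kSame p i τ then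
      ((Equiv.Perm.sign τ : ℤ) : ℚ) • kR (kcollapse i ∘ τ) x else 0) = 0 := by
  have hne : i.castSucc ≠ i.succ := by simp [Fin.ext_iff]
  have hinvol : ∀ τ : Equiv.Perm (Fin (s+1)),
      Equiv.swap i.castSucc i.succ * (Equiv.swap i.castSucc i.succ * τ) = τ := by
    intro τ; rw [← mul_assoc, Equiv.swap_mul_self, one_mul]
  apply Finset.sum_involution (fun τ _ => Equiv.swap i.castSucc i.succ * τ)
  · intro τ _
    by_cases h : kIsShuf p τ ∧ ¬ kSame p i τ
    · rw [if_pos h, if_pos (swap_shuf p i τ h)]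
      have : kcollapse i ∘ (Equiv.swap i.castSucc i.succ * τ) = kcollapse i ∘ τ := by
        funext t
        simp only [Function.comp, Equiv.Perm.mul_apply, collapse_swap]
      rw [this, Equiv.Perm.sign_mul, Equiv.Perm.sign_swap hne, ← add_smul]
      refine smul_eq_zero_of_left ?_ _
      simp
    · rw [if_neg h, if_neg, add_zero]
      intro h'
      apply h
      have := swap_shuf p i _ h'
      rwa [hinvol] at this
  · intro τ _ _ he
    have : Equiv.swap i.castSucc i.succ = 1 := by simpa using he
    exact hne (Equiv.swap_eq_one_iff.1 this)
  · simp
  · intro τ _; exact hinvol τ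

lemma same_adj {s : ℕ} (p : ℕ) (i : Fin s) (τ : Equiv.Perm (Fin (s+1)))
    (h : kIsShuf p τ) (h2 : kSame p i τ) :
    ∃ j : Fin s, τ j.castSucc = i.castSucc ∧ τ j.succ = i.succ ∧ (j : ℕ) + 1 ≠ p := by
  rw [isShuf_iff] at h
  unfold kSame at h2
  set a := τ⁻¹ i.castSucc with ha
  set b := τ⁻¹ i.succ with hb
  have hta : τ a = i.castSucc := by simp [ha]
  have htb : τ b = i.succ := by simp [hb]
  have hab : a < b := by
    by_contra hc
    push Not at hc
    rcases hc.eq_or_lt with h3 | h3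
    · rw [← h3, htb] at hta
      simp [Fin.ext_iff] at hta
    · have := h b a h3 h2.symm
      rw [hta, htb] at this
      simp [Fin.lt_def] at this
  have hsucc : (b : ℕ) = a + 1 := by
    by_contra hc
    have hab' : (a : ℕ) < b := hab
    let c : Fin (s+1) := ⟨a + 1, by omega⟩
    have h3 := h a c (by simp [c, Fin.lt_def]) (by simp only [c]; omega)
    have h4 := h c b (by simp only [c, Fin.lt_def]; omega) (by simp only [c]; omega)
    rw [hta] at h3
    rw [htb] at h4
    simp only [Fin.lt_def, Fin.val_castSucc, Fin.val_succ] at h3 h4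
    omega
  refine ⟨⟨a, by omega⟩, ?_, ?_, ?_⟩
  · rw [← hta]; rfl
  · rw [← htb]; congr 1; ext; simp [hsucc]
  · simp only; omega

lemma kE_collapse {s : ℕ} (i j : Fin s) (e : Equiv.Perm (Fin s)) (he : e j = i) :
    kcollapse i ∘ kE i.succ j.succ (0, e) = e ∘ kcollapse j := by
  have hc : ∀ i k : Fin s, kcollapse i (i.succ.succAbove k) = k := by
    intro i k
    ext
    simp only [kcollapse_val, Fin.succAbove, Fin.lt_def, Fin.val_castSucc, Fin.val_succ]
    split_ifs <;> simp_all <;> omega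
  have hs : ∀ i : Fin s, kcollapse i i.succ = i := by
    intro i; ext; simp [kcollapse_val]
  funext t
  simp only [Function.comp]
  rcases Fin.eq_self_or_eq_succAbove j.succ t with rfl | ⟨k, rfl⟩
  · rw [kE_self, Fin.cycleRange_symm_zero, hs, hs, he]
  · rw [kE_succAbove, hc, hc]

lemma kcollapse_mono {s : ℕ} (i : Fin s) : Monotone (kcollapse i) := by
  intro a b hab
  simp only [Fin.le_def, kcollapse_val] at hab ⊢
  split_ifs <;> omega

lemma kE_shuf {s : ℕ} (p : ℕ) (i j : Fin s) (e : Equiv.Perm (Fin s)) (hj : (j : ℕ) + 1 ≠ p) :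
    (kIsShuf p (kE i.succ j.succ (0, e)) ∧ kE i.succ j.succ (0, e) j.castSucc = i.castSucc) ↔
    (e j = i ∧ kIsShuf (if (j : ℕ) + 1 < p then p - 1 else p) e) := by
  have hjj : ∀ j : Fin s, j.castSucc = j.succ.succAbove j := by
    intro j; simp
  have hval : kE i.succ j.succ (0, e) j.castSucc = i.castSucc ↔ e j = i := by
    rw [hjj j, kE_succAbove, hjj i]
    exact Fin.succAbove_right_inj
  rw [hval, and_comm]
  refine and_congr_right fun he => ?_
  have hcol := kE_collapse i j e he
  have hcol' : ∀ t, kcollapse i (kE i.succ j.succ (0, e) t) = e (kcollapse j t) :=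
    fun t => congrFun hcol t
  rw [← hval] at he
  have hes : kE i.succ j.succ (0, e) j.succ = i.succ := by
    rw [kE_self, Fin.cycleRange_symm_zero]
  set T := kE i.succ j.succ (0, e) with hT
  have hside : ∀ t : Fin (s+1), (kcollapse j t : ℕ) < (if (j : ℕ) + 1 < p then p - 1 else p) ↔
      (t : ℕ) < p := by
    intro t
    rw [kcollapse_val]
    split_ifs <;> omega
  rw [isShuf_iff, isShuf_iff]
  constructor
  · intro h k l hkl hs
    obtain ⟨a, rfl⟩ := kcollapse_surj j k
    obtain ⟨b, rfl⟩ := kcollapse_surj j l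
    rw [hside, hside] at hs
    have hab : a < b := by
      by_contra hc
      push Not at hc
      exact absurd hkl (not_lt.2 (kcollapse_mono j hc))
    have h1 := h a b hab hs
    rw [← hcol', ← hcol']
    refine lt_of_le_of_ne (kcollapse_mono i h1.le) ?_
    rw [hcol', hcol']
    exact fun h2 => hkl.ne (e.injective h2)
  · intro h a b hab hs
    rcases (kcollapse_mono j hab.le).eq_or_lt with h1 | h1
    · have h2 : a = j.castSucc ∧ b = j.succ := by
        have h3 := congrArg Fin.val h1
        simp only [kcollapse_val] at h3
        have : (a : ℕ) < b := hab
        constructor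
        · ext; simp only [Fin.val_castSucc]; split_ifs at h3 <;> omega
        · ext; simp only [Fin.val_succ]; split_ifs at h3 <;> omega
      rw [h2.1, h2.2, he, hes]
      simp [Fin.lt_def]
    · have h2 := h _ _ h1 (by rw [hside, hside]; exact hs)
      rw [← hcol', ← hcol'] at h2
      by_contra hc
      push Not at hc
      exact absurd h2 (not_lt.2 (kcollapse_mono i hc))

lemma diff_shufOp {r s : ℕ} (p : ℕ) (x : KBarPart r (s+1)) :
    kbarDiff r s (kshufOp p x) = ∑ j : Fin s, if (j : ℕ) + 1 = p then 0 else
      ((-1 : ℚ) ^ (j : ℕ)) •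
        kshufOp (if (j : ℕ) + 1 < p then p - 1 else p) (kR (kcollapse j) x) := by
  have step1 : kbarDiff r s (kshufOp p x) = ∑ i : Fin s, ∑ τ : Equiv.Perm (Fin (s+1)),
      ∑ j : Fin s, if (τ j.succ = i.succ) then
        (if (kIsShuf p τ ∧ τ j.castSucc = i.castSucc) ∧ (j : ℕ) + 1 ≠ p then
        (((-1 : ℚ) ^ (i : ℕ)) * ((Equiv.Perm.sign τ : ℤ) : ℚ)) • kR (kcollapse i ∘ τ) x else 0)
        else 0 := by
    rw [kbarDiff_kR]
    refine Finset.sum_congr rfl fun i _ => ?_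
    have h0 : kR (kcollapse i) (kshufOp p x) = ∑ τ : Equiv.Perm (Fin (s+1)),
        (if kIsShuf p τ ∧ kSame p i τ then
      ((Equiv.Perm.sign τ : ℤ) : ℚ) • kR (kcollapse i ∘ τ) x else 0) := by
      refine Eq.trans ?_ ((congrArg _ (cross_zero p i x)).trans (add_zero _))
      rw [← Finset.sum_add_distrib, kshufOp_kR, kR_sum]
      refine Finset.sum_congr rfl fun τ _ => ?_
      by_cases h1 : kIsShuf p τ
      · by_cases h2 : kSame p i τ
        · simp [h1, h2, kR_smul, kR_kR]
        · simp [h1, h2, kR_smul, kR_kR]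
      · simp [h1, kR_zero]
    rw [h0, Finset.smul_sum]
    refine Finset.sum_congr rfl fun τ _ => ?_
    by_cases h : kIsShuf p τ ∧ kSame p i τ
    · rw [if_pos h]
      obtain ⟨j, hj1, hj2, hj3⟩ := same_adj p i τ h.1 h.2
      rw [Finset.sum_eq_single j]
      · rw [if_pos hj2, if_pos ⟨⟨h.1, hj1⟩, hj3⟩, smul_smul]
      · intro k _ hk
        rw [if_neg]
        intro hk2
        rw [← hj2] at hk2
        exact hk (Fin.succ_injective _ (τ.injective hk2))
      · simp
    · rw [if_neg h, smul_zero]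
      symm
      refine Finset.sum_eq_zero fun j _ => ?_
      by_cases h1 : τ j.succ = i.succ
      · rw [if_pos h1, if_neg]
        rintro ⟨⟨h2, h3⟩, h4⟩
        apply h
        refine ⟨h2, ?_⟩
        unfold kSame
        rw [← h1, ← h3]
        simp
        omega
      · rw [if_neg h1]
  rw [step1]
  have step2 : ∀ i : Fin s, (∑ τ : Equiv.Perm (Fin (s+1)),
      ∑ j : Fin s, if (τ j.succ = i.succ) then
        (if (kIsShuf p τ ∧ τ j.castSucc = i.castSucc) ∧ (j : ℕ) + 1 ≠ p then
        (((-1 : ℚ) ^ (i : ℕ)) * ((Equiv.Perm.sign τ : ℤ) : ℚ)) • kR (kcollapse i ∘ τ) x else 0)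
        else 0) = ∑ j : Fin s, ∑ e : Equiv.Perm (Fin s),
          if (j : ℕ) + 1 = p then 0 else if e j = i then
            if kIsShuf (if (j : ℕ) + 1 < p then p - 1 else p) e then
              ((-1 : ℚ) ^ (j : ℕ) * ((Equiv.Perm.sign e : ℤ) : ℚ)) • kR e (kR (kcollapse j) x)
            else 0 else 0 := by
    intro i
    rw [Finset.sum_comm]
    refine Finset.sum_congr rfl fun j _ => ?_
    rw [sum_kE]
    refine Finset.sum_congr rfl fun e _ => ?_
    by_cases hj : (j : ℕ) + 1 = p
    · simp [hj]
    · simp only [if_neg hj, kE_shuf p i j e hj]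
      by_cases he : e j = i
      · rw [kE_collapse i j e he, kE_sign, kR_kR]
        simp only [he, hj, true_and, ne_eq, not_false_iff, and_true, if_true]
        congr 2
        simp only [Units.val_mul, Units.val_pow_eq_pow_val, Units.val_neg, Units.val_one,
          Int.cast_mul, Int.cast_pow, Int.cast_neg, Int.cast_one, Fin.val_succ, pow_succ]
        have : (-1 : ℚ) ^ (i : ℕ) * (-1) ^ (i : ℕ) = 1 := by
          rw [← mul_pow]; simp
        linear_combination (-1 : ℚ) ^ (j : ℕ) * ((Equiv.Perm.sign e : ℤ) : ℚ) * this
      · simp [he]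
  rw [Finset.sum_congr rfl fun i _ => step2 i, Finset.sum_comm]
  refine Finset.sum_congr rfl fun j _ => ?_
  rw [Finset.sum_comm]
  by_cases hj : (j : ℕ) + 1 = p
  · simp [hj]
  · simp only [hj, if_false]
    rw [kshufOp_kR, Finset.smul_sum]
    refine Finset.sum_congr rfl fun e _ => ?_
    rw [Finset.sum_ite_eq]
    simp only [Finset.mem_univ, if_true, smul_ite, smul_zero, smul_smul]

lemma diff_sh {r s : ℕ} (x : KBarPart r (s+1)) (hx : x ∈ kshuffleSub r (s+1)) :
    kbarDiff r s x ∈ kshuffleSub r s := by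
  have : kshuffleSub r (s+1) ≤ (kshuffleSub r s).comap (kbarDiff r s) := by
    rw [kshuffleSub_eq]
    refine Submodule.span_le.2 ?_
    rintro _ ⟨p, hp, hps, x, rfl⟩
    rw [SetLike.mem_coe, Submodule.mem_comap, diff_shufOp]
    refine Submodule.sum_mem _ fun j _ => ?_
    split_ifs with h1 h2
    · exact Submodule.zero_mem _
    · exact Submodule.smul_mem _ _ (kshufOp_mem _ (by omega) (by omega) _)
    · exact Submodule.smul_mem _ _ (kshufOp_mem _ (by omega) (by omega) _)
  exact this hx

lemma main1 (R t : ℕ) :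
    kSurj (R+1) (t+2) ⊓ Submodule.comap (kbarDiff (R+1) (t + 1)) (kshuffleSub (R+1) (t + 1)) =
    kSurj (R+1) (t+2) ⊓ (kshuffleSub (R+1) (t + 2) ⊔
            Submodule.map (kbarDiff (R+1) (t + 2)) (kSurj (R+1) (t+3))) := by
  apply le_antisymm
  · rintro x ⟨hx, hd⟩
    refine ⟨hx, ?_⟩
    rw [SetLike.mem_coe, Submodule.mem_comap] at hd
    obtain ⟨y, hy, z, hz, rfl⟩ := Submodule.mem_sup.1 (kSurj_le_sup _ _ hx)
    have hdy : kbarDiff (R+1) (t+1) y = 0 := by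
      apply kF_inf_sh _ (kF_diff y hy)
      rw [map_add] at hd
      exact (Submodule.add_mem_iff_left _ (diff_sh z hz)).1 hd
    have hh := khomotopy (Or.inl (Nat.succ_ne_zero t)) y hy
    rw [hdy, map_zero, add_zero] at hh
    refine Submodule.add_mem _ (Submodule.mem_sup_right ?_) (Submodule.mem_sup_left hz)
    exact ⟨_, kH_mem y hy, hh⟩
  · rintro x ⟨hx, hd⟩
    refine ⟨hx, ?_⟩
    rw [SetLike.mem_coe, Submodule.mem_comap]
    obtain ⟨y, hy, _, ⟨w, _, rfl⟩, rfl⟩ := Submodule.mem_sup.1 hd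
    rw [map_add, kbarDiff_sq, add_zero]
    exact diff_sh y hy

lemma main2 (R : ℕ) (hR : R ≠ 0) : kSurj (R+1) 1 ≤ kshuffleSub (R+1) 1 ⊔
    Submodule.map (kbarDiff (R+1) 1) (kSurj (R+1) 2) := by
  intro x hx
  have hy : x ∈ kF R 1 := by
    refine Submodule.span_mono ?_ hx
    rintro _ ⟨f, hf, rfl⟩
    exact ⟨f, hf, by omega, rfl⟩
  have hh := khomotopy (Or.inr hR) x hy
  have h0 : kbarDiff (R+1) 0 x = 0 := by simp [kbarDiff_apply]
  rw [h0, map_zero, add_zero] at hh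
  exact Submodule.mem_sup_right ⟨_, kH_mem x hy, hh⟩

lemma main3 : Nonempty ((↥(kSurj 1 1) ⧸ Submodule.comap (kSurj 1 1).subtype
    (kshuffleSub 1 1 ⊔ Submodule.map (kbarDiff 1 1) (kSurj 1 2))) ≃ₗ[ℚ] ℚ) := by
  have h1 : kshuffleSub 1 1 = ⊥ := by
    rw [kshuffleSub_eq, Submodule.span_eq_bot]
    rintro _ ⟨p, hp, hp1, _⟩
    omega
  have h2 : kSurj 1 2 = ⊥ := by
    rw [kSurj, Submodule.span_eq_bot]
    rintro _ ⟨f, hf, _⟩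
    exfalso
    have := Fintype.card_le_of_surjective f hf
    simp at this
  have h3 : kSurj 1 1 = Submodule.span ℚ {kX (fun _ => 0)} := by
    unfold kSurj
    congr 1
    ext y
    constructor
    · rintro ⟨f, _, rfl⟩
      rw [Set.mem_singleton_iff]
      congr 1
      exact Subsingleton.elim _ _
    · intro hy
      refine ⟨_, ?_, hy⟩
      intro i
      exact ⟨0, Subsingleton.elim _ _⟩
  have hne : (kX (fun _ => 0) : KBarPart 1 1) ≠ 0 := by
    unfold kX
    rw [Ne, monomial_eq_zero]
    exact one_ne_zero
  have hbot : Submodule.comap (kSurj 1 1).subtype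
    (kshuffleSub 1 1 ⊔ Submodule.map (kbarDiff 1 1) (kSurj 1 2)) = ⊥ := by
    rw [h1, h2, Submodule.map_bot, bot_sup_eq, Submodule.comap_bot, Submodule.ker_subtype]
  exact ⟨(Submodule.quotEquivOfEqBot _ hbot).trans ((LinearEquiv.ofEq _ _ h3).trans
    (LinearEquiv.toSpanNonzeroSingleton ℚ _ _ hne).symm)⟩

/-- arity-wise Koszulness of the Lie operad.  The homology
of the multilinear Harrison complex is the unit `Σ`-module: it vanishes in
all arities `r ≥ 2` (in every homological degree), and in arity `1` it is
one-dimensional. -/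
theorem stmt14 :
    -- vanishing in homological degrees ≥ 2 (all arities r ≥ 1):
    (∀ r t : ℕ, 1 ≤ r →
      kmultilinear r (t + 2) ⊓ kbarSub r (t + 2) ⊓
          Submodule.comap (kbarDiff r (t + 1)) (kshuffleSub r (t + 1)) =
        kmultilinear r (t + 2) ⊓ kbarSub r (t + 2) ⊓
          (kshuffleSub r (t + 2) ⊔
            Submodule.map (kbarDiff r (t + 2))
              (kmultilinear r (t + 3) ⊓ kbarSub r (t + 3)))) ∧
    -- vanishing in homological degree 1 for arities r ≥ 2:
    (∀ r : ℕ, 2 ≤ r →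
      kmultilinear r 1 ⊓ kbarSub r 1 ≤
        kshuffleSub r 1 ⊔
          Submodule.map (kbarDiff r 1) (kmultilinear r 2 ⊓ kbarSub r 2)) ∧
    -- in arity 1 the homology is one-dimensional, concentrated in degree 1:
    Nonempty
      ((↥(kmultilinear 1 1 ⊓ kbarSub 1 1) ⧸
        Submodule.comap (kmultilinear 1 1 ⊓ kbarSub 1 1).subtype
          (kshuffleSub 1 1 ⊔
            Submodule.map (kbarDiff 1 1) (kmultilinear 1 2 ⊓ kbarSub 1 2)))
        ≃ₗ[ℚ] ℚ) := by
  refine ⟨?_, ?_, ?_⟩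
  · intro r t hr
    obtain ⟨R, rfl⟩ := Nat.exists_eq_add_of_le' hr
    rw [kSurj_eq, kSurj_eq]
    exact main1 R t
  · intro r hr
    obtain ⟨R, rfl⟩ := Nat.exists_eq_add_of_le' (show 1 ≤ r by omega)
    rw [kSurj_eq, kSurj_eq]
    exact main2 R (by omega)
  · rw [kSurj_eq 1 1, kSurj_eq 1 2]
    exact main3

end
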